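/- Let φ : S → T be an isomorphism of finite inverse semigroups, let L(S) be the set of lonely idempotents of S and L(T) the set of lonely idempotents of T, and let β : L(S) → L(T) be any bijection. Define γ : S → T by γ(x) = β(x) for x ∈ L(S) and γ(x) = φ(x) for x ∉ L(S). Then γ is an isomorphism of inverse semigroups. -/

import Mathlib

/-- An inverse semigroup: a nonempty semigroup in which every element `x` has a
unique element `y` with `x*y*x = x` and `y*x*y = y`; this `y` is `inv x`. -/
class InverseSemigroup (S : Type*) extends Semigroup S where
  nonempty : Nonempty S
  inv : S → S
  mul_inv_mul : ∀ x : S, x * inv x * x = x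
  inv_mul_inv : ∀ x : S, inv x * x * inv x = inv x
  inv_unique : ∀ x y : S, x * y * x = x → y * x * y = y → y = inv x

namespace InverseSemigroup

variable {S : Type*}

/-- The natural partial order: `s ≤ t` iff `s = e * t` for some idempotent `e`. -/
def nle [InverseSemigroup S] (s t : S) : Prop := ∃ e : S, e * e = e ∧ s = e * t

/-- Strict version of the natural partial order. -/
def nlt [InverseSemigroup S] (s t : S) : Prop := nle s t ∧ s ≠ t

/-- Green's D-relation: `s D t` iff there is `z` with `z⁻¹z = t⁻¹t` and `zz⁻¹ = ss⁻¹`. -/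
def dRel [InverseSemigroup S] (s t : S) : Prop :=
  ∃ z : S, inv z * z = inv t * t ∧ z * inv z = s * inv s

/-- `m` is the minimum element of the semilattice of idempotents `(E(S), ≤)`. -/
def IsMinIdem [InverseSemigroup S] (m : S) : Prop :=
  m * m = m ∧ ∀ f : S, f * f = f → nle m f

/-- `e` is a lonely idempotent (relative to the minimum idempotent `m`):
`G_e = {e}`, `{e}` is a D-class, `e` covers `m` in `E(S)`, and `e` is not
covered by any idempotent. -/
def Lonely [InverseSemigroup S] (m e : S) : Prop :=
  e * e = e ∧
  (∀ s : S, s * inv s = e → inv s * s = e → s = e) ∧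
  (∀ s : S, dRel s e → s = e) ∧
  nlt m e ∧ (¬ ∃ h : S, h * h = h ∧ nlt m h ∧ nlt h e) ∧
  ¬ ∃ h : S, h * h = h ∧ nlt e h ∧ ¬ ∃ h' : S, h' * h' = h' ∧ nlt e h' ∧ nlt h' h

end InverseSemigroup

open InverseSemigroup

namespace InverseSemigroup

variable {S : Type*} [InverseSemigroup S]

theorem inv_eq_self {e : S} (he : e * e = e) : inv e = e :=
  (inv_unique e e (by rw [he, he]) (by rw [he, he])).symm

theorem mul_inv_idem (s : S) : s * inv s * (s * inv s) = s * inv s := by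
  rw [← mul_assoc, mul_inv_mul]

theorem inv_mul_idem (s : S) : inv s * s * (inv s * s) = inv s * s := by
  rw [← mul_assoc, inv_mul_inv]

theorem idem_mul_idem {e f : S} (he : e * e = e) (hf : f * f = f) :
    e * f * (e * f) = e * f := by
  have h₁ := mul_inv_mul (e * f)
  have h₂ := inv_mul_inv (e * f)
  have he' : ∀ a, e * (e * a) = e * a := fun a => by rw [← mul_assoc, he]
  have hf' : ∀ a, f * (f * a) = f * a := fun a => by rw [← mul_assoc, hf]
  have hx : f * inv (e * f) * e = inv (e * f) := by
    refine inv_unique (e * f) _ ?_ ?_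
    · simpa only [mul_assoc, he', hf'] using h₁
    · have := congrArg (fun a => f * a * e) h₂
      simpa only [mul_assoc, he', hf'] using this
  have hxx : inv (e * f) * inv (e * f) = inv (e * f) := by
    calc inv (e * f) * inv (e * f)
        = (f * inv (e * f) * e) * (f * inv (e * f) * e) := by rw [hx]
      _ = f * (inv (e * f) * (e * f) * inv (e * f)) * e := by simp only [mul_assoc]
      _ = inv (e * f) := by rw [h₂, hx]
  have hef : e * f = inv (e * f) := by
    rw [← inv_eq_self hxx]
    exact inv_unique _ _ h₂ h₁
  rw [hef, hxx]

theorem idem_comm {e f : S} (he : e * e = e) (hf : f * f = f) : e * f = f * e := by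
  have hef := idem_mul_idem he hf
  have hfe := idem_mul_idem hf he
  have he' : ∀ a, e * (e * a) = e * a := fun a => by rw [← mul_assoc, he]
  have hf' : ∀ a, f * (f * a) = f * a := fun a => by rw [← mul_assoc, hf]
  have h : f * e = inv (e * f) := by
    refine inv_unique _ _ ?_ ?_
    · simpa only [mul_assoc, he', hf'] using hef
    · simpa only [mul_assoc, he', hf'] using hfe
  rw [h, inv_eq_self hef]

theorem nle_iff {a b : S} (ha : a * a = a) (hb : b * b = b) : nle a b ↔ a * b = a := by
  constructor
  · rintro ⟨e, -, rfl⟩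
    rw [mul_assoc, hb]
  · intro h
    exact ⟨a, ha, h.symm⟩

theorem eq_of_not_covered [Finite S] {e p : S} (he : e * e = e)
    (hcov : ¬ ∃ h : S, h * h = h ∧ nlt e h ∧ ¬ ∃ h' : S, h' * h' = h' ∧ nlt e h' ∧ nlt h' h)
    (hp : p * p = p) (hep : e * p = e) : p = e := by
  by_contra hne
  let r : S → S → Prop := fun a b => a * a = a ∧ b * b = b ∧ a * b = a ∧ a ≠ b
  have : IsTrans S r := ⟨fun a b c ⟨ha, hb, hab, hne⟩ ⟨_, hc, hbc, _⟩ => by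
    refine ⟨ha, hc, by rw [← hab, mul_assoc, hbc], ?_⟩
    rintro rfl
    exact hne (by rw [← hab, idem_comm ha hb, hbc])⟩
  have : Std.Irrefl r := ⟨fun a h => h.2.2.2 rfl⟩
  obtain ⟨h, ⟨hh, heh, hne⟩, hmin⟩ :=
    (Finite.wellFounded_of_trans_of_irrefl r).has_min
      {h | h * h = h ∧ e * h = e ∧ e ≠ h} ⟨p, hp, hep, Ne.symm hne⟩
  refine hcov ⟨h, hh, ⟨(nle_iff he hh).2 heh, hne⟩, ?_⟩
  rintro ⟨k, hk, ⟨hek, hek'⟩, hkh, hkh'⟩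
  exact hmin k ⟨hk, (nle_iff he hk).1 hek, hek'⟩ ⟨hk, hh, (nle_iff hk hh).1 hkh, hkh'⟩

theorem IsMinIdem.mul_right {m : S} (hm : IsMinIdem m) {f : S} (hf : f * f = f) : m * f = m :=
  (nle_iff hm.1 hf).1 (hm.2 f hf)

theorem IsMinIdem.mul_left {m : S} (hm : IsMinIdem m) {f : S} (hf : f * f = f) : f * m = m := by
  rw [← idem_comm hm.1 hf, hm.mul_right hf]

/-- A lonely idempotent multiplies every other element in the same way as the minimum idempotent;
this characterizes lonely idempotents. -/
theorem lonely_iff [Finite S] {m e : S} (hm : IsMinIdem m) :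
    Lonely m e ↔ e * e = e ∧ e ≠ m ∧ ∀ s, s ≠ e → e * s = m * s ∧ s * e = s * m := by
  constructor
  · rintro ⟨he, -, hD, ⟨-, hne⟩, hmin, hcov⟩
    have key : ∀ p : S, p * p = p → p ≠ e → e * p = m := by
      intro p hp hpe
      by_contra hepm
      have hep := idem_mul_idem he hp
      refine hmin ⟨e * p, hep, ⟨hm.2 _ hep, Ne.symm hepm⟩, (nle_iff hep he).2 ?_, ?_⟩
      · rw [mul_assoc, idem_comm hp he, ← mul_assoc, he]
      · exact fun h => hpe (eq_of_not_covered he hcov hp h)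
    refine ⟨he, hne.symm, fun s hs => ⟨?_, ?_⟩⟩
    · have h := key _ (mul_inv_idem s) fun h =>
        hs (hD s ⟨e, rfl, by rw [inv_eq_self he, he, h]⟩)
      calc e * s = e * (s * inv s) * s := by rw [mul_assoc, mul_inv_mul]
        _ = m * s := by rw [h]
    · have h := key _ (inv_mul_idem s) fun h =>
        hs (hD s ⟨s, by rw [inv_eq_self he, he, h], rfl⟩)
      rw [idem_comm he (inv_mul_idem s)] at h
      calc s * e = s * (inv s * s * e) := by rw [← mul_assoc, ← mul_assoc, mul_inv_mul]
        _ = s * m := by rw [h]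
  · rintro ⟨he, hne, H⟩
    have left : ∀ s : S, s * inv s = e → s = e := by
      intro s h
      by_contra hs
      have h₁ : m * s = s := by rw [← (H s hs).1, ← h, mul_inv_mul]
      refine hne ?_
      rw [← h, ← h₁, mul_assoc, h₁, h, hm.mul_right he]
    have right : ∀ s : S, inv s * s = e → s = e := by
      intro s h
      by_contra hs
      have h₁ : s * m = s := by rw [← (H s hs).2, ← h, ← mul_assoc, mul_inv_mul]
      refine hne ?_
      rw [← hm.mul_left he, ← h, mul_assoc, h₁]
    refine ⟨he, fun s h _ => left s h, ?_, ⟨hm.2 e he, hne.symm⟩, ?_, ?_⟩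
    · rintro s ⟨z, h₁, h₂⟩
      rw [inv_eq_self he, he] at h₁
      obtain rfl := right z h₁
      rw [inv_eq_self he, he] at h₂
      exact left s h₂.symm
    · rintro ⟨h, hh, ⟨-, hmh⟩, hhe, hhe'⟩
      refine hmh ?_
      rw [← (nle_iff hh he).1 hhe, (H h hhe').2, hm.mul_left hh]
    · rintro ⟨h, hh, ⟨heh, hne'⟩, -⟩
      refine hne ?_
      rw [← (nle_iff he hh).1 heh, (H h hne'.symm).1, hm.mul_right hh]

theorem Lonely.eq_of_mul_eq [Finite S] {m e s t : S} (hm : IsMinIdem m) (he : Lonely m e)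
    (h : s * t = e) : s = e ∧ t = e := by
  obtain ⟨hee, hne, H⟩ := (lonely_iff hm).1 he
  constructor
  · by_contra hs
    refine hne ?_
    calc e = e * s * t := by rw [mul_assoc, h, hee]
      _ = m := by rw [(H s hs).1, mul_assoc, h, hm.mul_right hee]
  · by_contra ht
    refine hne ?_
    calc e = s * (t * e) := by rw [← mul_assoc, h, hee]
      _ = m := by rw [(H t ht).2, ← mul_assoc, h, hm.mul_left hee]

variable {T : Type*} [InverseSemigroup T]

theorem IsMinIdem.map {φ : S → T} (hφ : Function.Bijective φ)
    (hmul : ∀ s t : S, φ (s * t) = φ s * φ t) {m : S} (hm : IsMinIdem m) {n : T}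
    (hn : IsMinIdem n) : φ m = n := by
  obtain ⟨p, rfl⟩ := hφ.2 n
  have hp : p * p = p := hφ.1 (by rw [hmul, hn.1])
  rw [← hm.mul_right hp, hmul, hn.mul_left (by rw [← hmul, hm.1])]

theorem lonely_map_iff [Finite S] [Finite T] {φ : S → T} (hφ : Function.Bijective φ)
    (hmul : ∀ s t : S, φ (s * t) = φ s * φ t) {m : S} (hm : IsMinIdem m) {n : T}
    (hn : IsMinIdem n) (e : S) : Lonely n (φ e) ↔ Lonely m e := by
  rw [lonely_iff hm, lonely_iff hn, hφ.2.forall, ← hm.map hφ hmul hn]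
  simp only [← hmul, hφ.1.eq_iff, ne_eq]

end InverseSemigroup

/-- Replacing an isomorphism on the lonely idempotents by an
arbitrary bijection of the lonely idempotents again yields an isomorphism. -/
theorem lonely_rearranged_iso
    {S T : Type*} [InverseSemigroup S] [InverseSemigroup T] [Finite S] [Finite T]
    (φ : S → T) (hbij : Function.Bijective φ)
    (hmul : ∀ s t : S, φ (s * t) = φ s * φ t)
    (mS : S) (hmS : IsMinIdem mS) (mT : T) (hmT : IsMinIdem mT)
    (β : S → T) (hβ : Set.BijOn β {e : S | Lonely mS e} {e : T | Lonely mT e})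
    (γ : S → T)
    (hγ₁ : ∀ x : S, Lonely mS x → γ x = β x)
    (hγ₂ : ∀ x : S, ¬ Lonely mS x → γ x = φ x) :
    Function.Bijective γ ∧ ∀ s t : S, γ (s * t) = γ s * γ t := by
  have hφL := lonely_map_iff hbij hmul hmS hmT
  have hφm := hmS.map hbij hmul hmT
  have hγL : ∀ x, Lonely mT (γ x) ↔ Lonely mS x := by
    intro x
    by_cases hx : Lonely mS x
    · rw [hγ₁ x hx]
      exact iff_of_true (hβ.mapsTo hx) hx
    · rw [hγ₂ x hx, hφL]
  have hinj : Function.Injective γ := by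
    intro x y hxy
    have hiff : Lonely mS x ↔ Lonely mS y := by rw [← hγL, hxy, hγL]
    by_cases hx : Lonely mS x
    · have hy := hiff.1 hx
      rw [hγ₁ x hx, hγ₁ y hy] at hxy
      exact hβ.injOn hx hy hxy
    · rw [hγ₂ x hx, hγ₂ y (mt hiff.2 hx)] at hxy
      exact hbij.1 hxy
  refine ⟨⟨hinj, fun y => ?_⟩, fun s t => ?_⟩
  · by_cases hy : Lonely mT y
    · obtain ⟨x, hx, rfl⟩ := hβ.surjOn hy
      exact ⟨x, hγ₁ x hx⟩
    · obtain ⟨x, rfl⟩ := hbij.2 y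
      exact ⟨x, hγ₂ x (mt (hφL x).2 hy)⟩
  · by_cases hst : Lonely mS (s * t)
    · obtain ⟨h₁, h₂⟩ := hst.eq_of_mul_eq hmS rfl
      have h : γ s * γ s = γ s := ((hγL s).2 (by rwa [h₁])).1
      rw [← h₁] at h₂ ⊢
      rw [h₂, h]
    · have hne : Lonely mS s → t ≠ s := by
        rintro hs rfl
        exact hst (by rwa [hs.1])
      have hne' : Lonely mS t → s ≠ t := by
        rintro ht rfl
        exact hst (by rwa [ht.1])
      have mul_min_left : ∀ x, mT * γ x = mT * φ x := by
        intro x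
        by_cases hx : Lonely mS x
        · rw [hmT.mul_right ((hγL x).2 hx).1, hmT.mul_right ((hφL x).2 hx).1]
        · rw [hγ₂ x hx]
      rw [hγ₂ _ hst]
      by_cases hs : Lonely mS s
      · rw [(((lonely_iff hmS).1 hs).2.2 t (hne hs)).1,
          (((lonely_iff hmT).1 ((hγL s).2 hs)).2.2 (γ t) (hinj.ne (hne hs))).1,
          hmul, hφm, mul_min_left]
      · by_cases ht : Lonely mS t
        · rw [(((lonely_iff hmS).1 ht).2.2 s (hne' ht)).2,
            (((lonely_iff hmT).1 ((hγL t).2 ht)).2.2 (γ s) (hinj.ne (hne' ht))).2,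
            hmul, hφm, hγ₂ s hs]
        · rw [hmul, hγ₂ s hs, hγ₂ t ht]
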